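/- Let f : (0,∞) → ℝ be a convex lower semi-continuous function with f(1) = 0 that is continuous on (0,∞), twice differentiable at t = 1, and satisfies f''(1) > 0. Then for every α ∈ (0,1) there exists ε ∈ (0,1) such that for every pair of probability measures P, Q on Ω₁×⋯×Ω_n (standard Borel spaces) that are both Bayes-nets with respect to a common DAG G, that are mutually absolutely continuous, and whose density satisfies 1 − ε < dP/dQ(x) < 1 + ε for all x ∈ Ω, it holds that α·D_f(P,Q) ≤ Σ_{i=1}^n D_f(P_{X_i∪X_{Π_i}}, Q_{X_i∪X_{Π_i}}). -/

import Mathlib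

open MeasureTheory ProbabilityTheory Filter
open scoped ENNReal NNReal

noncomputable section

universe u

/-- Projection of a point of a product space onto the coordinates in `S`. -/
def proj {n : ℕ} {Ω : Fin n → Type*} (S : Finset (Fin n)) (x : ∀ i, Ω i) (i : S) : Ω i := x i

lemma measurable_proj {n : ℕ} {Ω : Fin n → Type*} [∀ i, MeasurableSpace (Ω i)]
    (S : Finset (Fin n)) : Measurable (proj (Ω := Ω) S) :=
  measurable_pi_lambda _ fun _ => measurable_pi_apply _

/-- A finite measure `P` on a product of standard Borel spaces is a Bayes-net with respect to
the parent structure `par` (for the topological ordering `0 < 1 < ⋯ < n-1`) if, for every `i`,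
the `i`-th coordinate is conditionally independent of the tuple of previous coordinates given
the tuple of parent coordinates `par i`. -/
def IsBayesNet {n : ℕ} {Ω : Fin n → Type*} [∀ i, MeasurableSpace (Ω i)]
    [∀ i, StandardBorelSpace (Ω i)] [∀ i, Nonempty (Ω i)]
    (P : Measure (∀ i, Ω i)) [IsFiniteMeasure P] (par : Fin n → Finset (Fin n)) : Prop :=
  ∀ i : Fin n,
    CondIndepFun (MeasurableSpace.comap (proj (par i)) inferInstance)
      ((measurable_proj (par i)).comap_le) (fun x => x i) (proj (Finset.Iio i)) P

/-- The `f`-divergence `D_f(P,Q) = ∫ f(dP/dQ) dQ` (for `P` absolutely continuous w.r.t. `Q`). -/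
def fDiv (f : ℝ → ℝ) {Ω : Type*} [MeasurableSpace Ω] (P Q : Measure Ω) : ℝ :=
  ∫ x, f ((P.rnDeriv Q x).toReal) ∂Q

open InformationTheory

lemma map_compProd_compProd_prodMkRight {γ β β' : Type*} [MeasurableSpace γ] [MeasurableSpace β]
    [MeasurableSpace β'] (μ : Measure γ) [SFinite μ] (κ : Kernel γ β)
    (η : Kernel γ β') [IsSFiniteKernel κ] [IsSFiniteKernel η] :
    ((μ ⊗ₘ κ) ⊗ₘ η.prodMkRight β).map (fun p => ((p.1.1, p.2), p.1.2)) =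
      (μ ⊗ₘ η) ⊗ₘ κ.prodMkRight β' := by
  ext s hs
  have hm : Measurable (fun p : (γ × β) × β' => ((p.1.1, p.2), p.1.2)) := by fun_prop
  have h1 : Measurable (s.indicator (1 : (γ × β') × β → ℝ≥0∞)) := measurable_one.indicator hs
  have h2 : Measurable fun p : (γ × β) × β' =>
      s.indicator (1 : (γ × β') × β → ℝ≥0∞) ((p.1.1, p.2), p.1.2) :=
    h1.comp hm
  rw [← lintegral_indicator_one hs, ← lintegral_indicator_one hs, lintegral_map h1 hm,
    Measure.lintegral_compProd h2, Measure.lintegral_compProd h1,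
    Measure.lintegral_compProd (by fun_prop), Measure.lintegral_compProd (by fun_prop)]
  refine lintegral_congr fun x => ?_
  simp only [Kernel.prodMkRight_apply]
  exact lintegral_lintegral_swap (by fun_prop)

/-- If `F` and `g` are conditionally independent given `k` under both `P` and `Q`, then the
Kullback-Leibler divergence of the joint laws is subadditive. -/
lemma klDiv_map_prodMk_le_of_condIndepFun {Ω γ β β' : Type*} [MeasurableSpace Ω]
    [StandardBorelSpace Ω] [MeasurableSpace γ] [MeasurableSpace β] [StandardBorelSpace β] [Nonempty β]
    [MeasurableSpace β'] [StandardBorelSpace β'] [Nonempty β']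
    {P Q : Measure Ω} [IsProbabilityMeasure P] [IsProbabilityMeasure Q]
    {k : Ω → γ} {g : Ω → β'} {F : Ω → β} (hk : Measurable k) (hg : Measurable g)
    (hF : Measurable F)
    (hP : CondIndepFun (MeasurableSpace.comap k inferInstance) hk.comap_le F g P)
    (hQ : CondIndepFun (MeasurableSpace.comap k inferInstance) hk.comap_le F g Q) :
    klDiv (P.map fun x => ((k x, g x), F x)) (Q.map fun x => ((k x, g x), F x)) ≤
      klDiv (P.map fun x => (k x, g x)) (Q.map fun x => (k x, g x)) +
        klDiv (P.map fun x => (k x, F x)) (Q.map fun x => (k x, F x)) := by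
  have key : ∀ (R : Measure Ω) [IsProbabilityMeasure R],
      CondIndepFun (MeasurableSpace.comap k inferInstance) hk.comap_le F g R →
      R.map (fun x => ((k x, g x), F x)) =
        R.map (fun x => (k x, g x)) ⊗ₘ (condDistrib F k R).prodMkRight β' := by
    intro R _ hR
    rw [← compProd_map_condDistrib (X := fun x => (k x, g x)) hF.aemeasurable]
    exact Measure.compProd_congr
      ((condIndepFun_iff_condDistrib_prod_ae_eq_prodMkRight hF hg hk).1 hR.symm)
  have : IsProbabilityMeasure (P.map k) := Measure.isProbabilityMeasure_map hk.aemeasurable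
  have : IsProbabilityMeasure (Q.map k) := Measure.isProbabilityMeasure_map hk.aemeasurable
  have : IsProbabilityMeasure (P.map fun x => (k x, g x)) :=
    Measure.isProbabilityMeasure_map (by fun_prop)
  have : IsProbabilityMeasure (Q.map fun x => (k x, g x)) :=
    Measure.isProbabilityMeasure_map (by fun_prop)
  rw [key P hP, key Q hQ, klDiv_compProd_eq_add]
  refine add_le_add le_rfl ?_
  rw [← compProd_map_condDistrib (X := k) (μ := P) hg.aemeasurable,
    ← map_compProd_compProd_prodMkRight (P.map k) (condDistrib F k P),
    ← map_compProd_compProd_prodMkRight (P.map k) (condDistrib F k Q),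
    ← compProd_map_condDistrib (X := k) (μ := P) hF.aemeasurable,
    ← compProd_map_condDistrib (X := k) (μ := Q) hF.aemeasurable]
  refine le_trans (klDiv_map_le _ _ ?_) ?_
  · fun_prop
  rw [klDiv_compProd_left, klDiv_compProd_eq_add (P.map k) (Q.map k)]
  exact le_add_self

lemma eventually_abs_le_mul_sq {g g' : ℝ → ℝ} {a : ℝ} (hg : ∀ᶠ t in nhds a, HasDerivAt g (g' t) t)
    (ha : g a = 0) (ha' : g' a = 0) (hg' : HasDerivAt g' 0 a) {η : ℝ} (hη : 0 < η) :
    ∀ᶠ t in nhds a, |g t| ≤ η * (t - a) ^ 2 := by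
  have h1 : ∀ᶠ t in nhds a, |g' t| ≤ η * |t - a| := by
    have := (hasDerivAt_iff_isLittleO.1 hg').def hη
    simpa [ha'] using this
  obtain ⟨r, hr, hball⟩ := Metric.eventually_nhds_iff_ball.1 (hg.and h1)
  filter_upwards [Metric.ball_mem_nhds a hr] with t ht
  have hsub : Set.uIcc a t ⊆ Metric.ball a r := by
    rw [← segment_eq_uIcc]
    exact (convex_ball a r).segment_subset (Metric.mem_ball_self hr) ht
  have := (convex_uIcc a t).norm_image_sub_le_of_norm_hasDerivWithin_le (f := g) (f' := g')
    (C := η * |t - a|) (fun x hx => (hball x (hsub hx)).1.hasDerivWithinAt)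
    (fun x hx => (hball x (hsub hx)).2.trans
      (mul_le_mul_of_nonneg_left (Set.abs_sub_left_of_mem_uIcc hx) hη.le))
    Set.left_mem_uIcc Set.right_mem_uIcc
  rw [ha, sub_zero, Real.norm_eq_abs, Real.norm_eq_abs] at this
  rwa [← sq_abs, sq, ← mul_assoc]

lemma eventually_abs_sub_klFun_le {f f' : ℝ → ℝ} {c δ : ℝ} (hone : f 1 = 0)
    (hderiv : ∀ᶠ t in nhds (1:ℝ), HasDerivAt f (f' t) t)
    (hderiv2 : HasDerivAt f' c 1) (hc : 0 < c) (hδ : 0 < δ) :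
    ∀ᶠ t in nhds (1:ℝ), |f t - f' 1 * (t - 1) - c * klFun t| ≤ δ * (c * klFun t) := by
  have hne : ∀ᶠ t in nhds (1:ℝ), t ≠ 0 := eventually_ne_nhds one_ne_zero
  have hlog : HasDerivAt Real.log 1 1 := by simpa using Real.hasDerivAt_log one_ne_zero
  have h1 : ∀ᶠ t in nhds (1:ℝ), |klFun t - (t - 1) ^ 2 / 2| ≤ 1 / 4 * (t - 1) ^ 2 := by
    refine eventually_abs_le_mul_sq (g := fun t => klFun t - (t - 1) ^ 2 / 2)
      (g' := fun t => Real.log t - (t - 1)) ?_ (by simp [klFun_one]) (by simp) ?_ (by norm_num)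
    · filter_upwards [hne] with t ht
      exact ((hasDerivAt_klFun ht).sub
        ((((hasDerivAt_id t).sub_const 1).pow 2).div_const 2)).congr_deriv (by simp)
    · simpa using! hlog.sub ((hasDerivAt_id (1:ℝ)).sub_const 1)
  have h2 : ∀ᶠ t in nhds (1:ℝ), |f t - f' 1 * (t - 1) - c * klFun t| ≤
      δ * c / 4 * (t - 1) ^ 2 := by
    refine eventually_abs_le_mul_sq (g := fun t => f t - f' 1 * (t - 1) - c * klFun t)
      (g' := fun t => f' t - f' 1 - c * Real.log t) ?_ (by simp [hone, klFun_one])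
      (by simp) ?_
      (by positivity)
    · filter_upwards [hne, hderiv] with t ht hft
      exact ((hft.sub (((hasDerivAt_id t).sub_const 1).const_mul (f' 1))).sub
        ((hasDerivAt_klFun ht).const_mul c)).congr_deriv (by simp)
    · simpa using! (hderiv2.sub_const (f' 1)).sub (hlog.const_mul c)
  filter_upwards [h1, h2] with t ht1 ht2
  have := (abs_le.1 ht1).1
  have hδc : 0 < δ * c := by positivity
  nlinarith

lemma abs_fDiv_sub_klDiv_le {Ω : Type*} [MeasurableSpace Ω] {P Q : Measure Ω}
    [IsProbabilityMeasure P] [IsProbabilityMeasure Q] (hPQ : P ≪ Q) {f : ℝ → ℝ} {b c δ ε : ℝ}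
    (hcont : ContinuousOn f (Set.Icc (1 - ε) (1 + ε))) (hε : 0 ≤ ε)
    (hf : ∀ t ∈ Set.Icc (1 - ε) (1 + ε),
      |f t - b * (t - 1) - c * klFun t| ≤ δ * (c * klFun t))
    (hd : ∀ᵐ x ∂Q, (P.rnDeriv Q x).toReal ∈ Set.Icc (1 - ε) (1 + ε)) :
    |fDiv f P Q - c * (klDiv P Q).toReal| ≤ δ * (c * (klDiv P Q).toReal) ∧ klDiv P Q ≠ ∞ := by
  have hint : ∀ g : ℝ → ℝ, ContinuousOn g (Set.Icc (1 - ε) (1 + ε)) →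
      Integrable (fun x => g (P.rnDeriv Q x).toReal) Q := by
    intro g hg
    have hle : 1 - ε ≤ 1 + ε := by linarith
    obtain ⟨C, hC⟩ := isCompact_Icc.exists_bound_of_continuousOn hg
    refine Integrable.of_bound (C := C) ?_ ?_
    · have : Measurable fun x => Set.IccExtend hle (Set.domRestrict _ g) (P.rnDeriv Q x).toReal :=
        (continuousOn_iff_continuous_domRestrict.1 hg).Icc_extend'.measurable.comp
          (Measure.measurable_rnDeriv P Q).ennreal_toReal
      refine this.aestronglyMeasurable.congr ?_
      filter_upwards [hd] with x hx
      rw [Set.IccExtend_of_mem _ _ hx, Set.domRestrict_apply]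
    · filter_upwards [hd] with x hx using hC _ hx
  have hk := hint klFun continuous_klFun.continuousOn
  have hφ := hint (fun t => b * (t - 1)) (by fun_prop)
  have hφ0 : ∫ x, b * ((P.rnDeriv Q x).toReal - 1) ∂Q = 0 := by
    rw [integral_const_mul, integral_sub Measure.integrable_toReal_rnDeriv (integrable_const _),
      Measure.integral_toReal_rnDeriv hPQ]
    simp
  refine ⟨?_, klDiv_ne_top hPQ ((integrable_klFun_rnDeriv_iff hPQ).1 hk)⟩
  rw [toReal_klDiv_eq_integral_klFun hPQ]
  have : fDiv f P Q - c * ∫ x, klFun (P.rnDeriv Q x).toReal ∂Q =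
      ∫ x, (f (P.rnDeriv Q x).toReal - b * ((P.rnDeriv Q x).toReal - 1)
        - c * klFun (P.rnDeriv Q x).toReal) ∂Q := by
    rw [integral_sub, integral_sub (hint f hcont) hφ, hφ0, integral_const_mul, sub_zero, fDiv]
    exacts [(hint f hcont).sub hφ, hk.const_mul c]
  rw [this, ← integral_const_mul, ← integral_const_mul]
  refine abs_integral_le_integral_abs.trans (integral_mono_ae ?_ ((hk.const_mul c).const_mul δ) ?_)
  · exact (((hint f hcont).sub hφ).sub (hk.const_mul c)).abs
  · filter_upwards [hd] with x hx using hf _ hx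

lemma rnDeriv_map_mem_Icc {Ω β : Type*} [MeasurableSpace Ω] [MeasurableSpace β] {P Q : Measure Ω}
    [IsFiniteMeasure P] [IsFiniteMeasure Q] (hPQ : P ≪ Q) {a b : ℝ} {g : Ω → β}
    (hg : Measurable g) (hd : ∀ᵐ x ∂Q, (P.rnDeriv Q x).toReal ∈ Set.Icc a b) :
    ∀ᵐ y ∂(Q.map g), ((P.map g).rnDeriv (Q.map g) y).toReal ∈ Set.Icc a b := by
  rw [ae_map_iff hg.aemeasurable
    ((Measure.measurable_rnDeriv _ _).ennreal_toReal measurableSet_Icc)]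
  have hi : Integrable (fun x => (P.rnDeriv Q x).toReal) Q := Measure.integrable_toReal_rnDeriv
  have h1 := condExp_mono (m := MeasurableSpace.comap g inferInstance) (integrable_const a) hi
    (hd.mono fun x hx => hx.1)
  have h2 := condExp_mono (m := MeasurableSpace.comap g inferInstance) hi (integrable_const b)
    (hd.mono fun x hx => hx.2)
  rw [condExp_const hg.comap_le] at h1 h2
  filter_upwards [h1, h2, toReal_rnDeriv_map hPQ hg] with x hx1 hx2 hx
  rw [hx]
  exact ⟨hx1, hx2⟩

lemma klDiv_map_le_of_factor {Ω β β' : Type*} [MeasurableSpace Ω] [MeasurableSpace β]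
    [MeasurableSpace β'] (P Q : Measure Ω) [IsFiniteMeasure P] [IsFiniteMeasure Q] {u : Ω → β}
    {v : Ω → β'} {φ : β' → β} (hv : Measurable v) (hφ : Measurable φ) (h : ∀ x, u x = φ (v x)) :
    klDiv (P.map u) (Q.map u) ≤ klDiv (P.map v) (Q.map v) := by
  have hu : u = φ ∘ v := funext h
  rw [hu, ← Measure.map_map hφ hv, ← Measure.map_map hφ hv]
  exact klDiv_map_le _ _ hφ

/-- The Kullback-Leibler divergence is subadditive over the neighbourhoods of a Bayes-net. -/
lemma IsBayesNet.klDiv_le_sum {n : ℕ} {Ω : Fin n → Type*} [∀ i, MeasurableSpace (Ω i)]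
    [∀ i, StandardBorelSpace (Ω i)] [∀ i, Nonempty (Ω i)] {par : Fin n → Finset (Fin n)}
    (hpar : ∀ i, par i ⊆ Finset.Iio i) {P Q : Measure (∀ i, Ω i)} [IsProbabilityMeasure P]
    [IsProbabilityMeasure Q] (hP : IsBayesNet P par) (hQ : IsBayesNet Q par) :
    klDiv P Q ≤ ∑ i, klDiv (P.map (proj (insert i (par i)))) (Q.map (proj (insert i (par i)))) := by
  have step : ∀ i : Fin n, klDiv (P.map (proj (Finset.Iic i))) (Q.map (proj (Finset.Iic i))) ≤
      klDiv (P.map (proj (Finset.Iio i))) (Q.map (proj (Finset.Iio i))) +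
        klDiv (P.map (proj (insert i (par i)))) (Q.map (proj (insert i (par i)))) := by
    intro i
    refine le_trans ?_ ((klDiv_map_prodMk_le_of_condIndepFun
      (measurable_proj (par i)) (measurable_proj (Finset.Iio i)) (measurable_pi_apply i)
      (hP i) (hQ i)).trans
      (add_le_add ?_ ?_))
    · refine klDiv_map_le_of_factor P Q (φ := fun p j =>
        if h : j.1 = i then cast (congrArg Ω h.symm) p.2 else
          p.1.2 ⟨j.1, Finset.mem_Iio.2 (lt_of_le_of_ne (Finset.mem_Iic.1 j.2) h)⟩)
        (((measurable_proj _).prodMk (measurable_proj _)).prodMk (measurable_pi_apply i)) ?_ ?_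
      · refine measurable_pi_lambda _ fun j => ?_
        rcases j with ⟨j, hj⟩
        by_cases h : j = i
        · subst h
          simpa using measurable_snd
        · simp only [h, dite_false]
          fun_prop
      · intro x
        ext j
        rcases j with ⟨j, hj⟩
        by_cases h : j = i
        · subst h
          simp [proj]
        · simp [proj, h]
    · exact klDiv_map_le_of_factor P Q
        (φ := fun p => (fun j : par i => p ⟨j.1, hpar i j.2⟩, p)) (measurable_proj _)
        (by fun_prop) fun x => rfl
    · exact klDiv_map_le_of_factor P Q
        (φ := fun p => (fun j : par i => p ⟨j.1, Finset.mem_insert_of_mem j.2⟩,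
          p ⟨i, Finset.mem_insert_self _ _⟩)) (measurable_proj _)
        (by fun_prop) fun x => rfl
  have main : ∀ m : ℕ, m ≤ n →
      klDiv (P.map (proj {j | (j : ℕ) < m})) (Q.map (proj {j | (j : ℕ) < m})) ≤
        ∑ i with (i : Fin n).1 < m,
          klDiv (P.map (proj (insert i (par i)))) (Q.map (proj (insert i (par i)))) := by
    intro m
    induction m with
    | zero =>
      intro _
      have h : ∀ (R : Measure (∀ i, Ω i)) [IsProbabilityMeasure R],
          R.map (proj {j | (j : ℕ) < 0}) =
            R.map (fun _ (j : ({j | (j : ℕ) < 0} : Finset (Fin n))) => Classical.arbitrary (Ω j)) := by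
        intro R _
        congr 1
        ext x j
        simpa using j.2
      rw [h P, h Q, Measure.map_const, Measure.map_const]
      simp
    | succ m ih =>
      intro hm
      have h1 : ({j | (j : ℕ) < m + 1} : Finset (Fin n)) = Finset.Iic ⟨m, hm⟩ := by
        ext j; simp [Fin.le_def]
      have h2 : ({j | (j : ℕ) < m} : Finset (Fin n)) = Finset.Iio ⟨m, hm⟩ := by
        ext j; simp [Fin.lt_def]
      have ih := ih (by omega)
      rw [h2] at ih
      rw [h1, ← Finset.Iio_insert, Finset.sum_insert (by simp), Finset.Iio_insert, add_comm]
      exact (step _).trans (add_le_add_left ih _)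
  have hid := klDiv_map_le_of_factor P Q (u := id) 
    (φ := fun p i => p ⟨i, Finset.mem_filter.2 ⟨Finset.mem_univ i, i.is_lt⟩⟩)
    (measurable_proj {j | (j : ℕ) < n}) (measurable_pi_lambda _ fun _ => measurable_pi_apply _)
    fun x => rfl
  rw [Measure.map_id, Measure.map_id] at hid
  simpa using hid.trans (main n le_rfl)

/-- Local linear subadditivity of `f`-divergences for two-sided close distributions: if `f`
is convex lower semi-continuous with `f(1) = 0`, continuous on `(0,∞)` and twice
differentiable at `1` with `f''(1) > 0` (witnessed by a derivative `f'` of `f` near `1` with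
`(f')'(1) = c > 0`), then for every `α ∈ (0,1)` there is `ε ∈ (0,1)` such that
`α · D_f(P,Q) ≤ ∑ᵢ D_f(P_{Xᵢ∪X_{Πᵢ}}, Q_{Xᵢ∪X_{Πᵢ}})` for all pairs of mutually
absolutely continuous Bayes-nets `P, Q` that are two-sided `ε`-close. -/
theorem fDiv_local_linear_subadditivity_two_sided_close
    (f : ℝ → ℝ)
    (hconvex : ConvexOn ℝ (Set.Ioi 0) f)
    (hlsc : LowerSemicontinuousOn f (Set.Ici 0))
    (hone : f 1 = 0)
    (hcont : ContinuousOn f (Set.Ioi 0))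
    (f' : ℝ → ℝ) (c : ℝ)
    (hderiv : ∀ᶠ t in nhds (1:ℝ), HasDerivAt f (f' t) t)
    (hderiv2 : HasDerivAt f' c 1) (hc : 0 < c)
    (α : ℝ) (hα : α ∈ Set.Ioo (0:ℝ) 1) :
    ∃ ε ∈ Set.Ioo (0:ℝ) 1,
      ∀ (n : ℕ) (Ω : Fin n → Type u) [∀ i, MeasurableSpace (Ω i)]
        [∀ i, StandardBorelSpace (Ω i)] [∀ i, Nonempty (Ω i)]
        (par : Fin n → Finset (Fin n)), (∀ i, par i ⊆ Finset.Iio i) →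
        ∀ (P Q : Measure (∀ i, Ω i)) [IsProbabilityMeasure P] [IsProbabilityMeasure Q],
        IsBayesNet P par → IsBayesNet Q par → P ≪ Q → Q ≪ P →
        ∀ h : (∀ i, Ω i) → ℝ, Measurable h →
          P = Q.withDensity (fun x => ENNReal.ofReal (h x)) →
          (∀ x, 1 - ε < h x ∧ h x < 1 + ε) →
          α * fDiv f P Q ≤ ∑ i : Fin n,
            fDiv f (P.map (proj (insert i (par i)))) (Q.map (proj (insert i (par i)))) := by
  have hδ : 0 < (1 - α) / 2 := by linarith [hα.2]
  obtain ⟨r, hr, hball⟩ := Metric.eventually_nhds_iff_ball.1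
    (eventually_abs_sub_klFun_le hone hderiv hderiv2 hc hδ)
  set δ := (1 - α) / 2 with hδ_def
  have hε0 : 0 < min (r / 2) (1 / 2) := by positivity
  have hεr : min (r / 2) (1 / 2) ≤ r / 2 := min_le_left _ _
  have hε1 : min (r / 2) (1 / 2) ≤ 1 / 2 := min_le_right _ _
  set ε := min (r / 2) (1 / 2)
  refine ⟨ε, ⟨hε0, by linarith⟩, ?_⟩
  intro n Ω _ _ _ par hpar P Q _ _ hP hQ hPQ _ h hh hPh hbound
  have hcontε : ContinuousOn f (Set.Icc (1 - ε) (1 + ε)) :=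
    hcont.mono fun t ht => lt_of_lt_of_le (by linarith) ht.1
  have hf : ∀ t ∈ Set.Icc (1 - ε) (1 + ε),
      |f t - f' 1 * (t - 1) - c * klFun t| ≤ δ * (c * klFun t) := fun t ht =>
    hball t (by rw [Metric.mem_ball, Real.dist_eq, abs_lt]; constructor <;> linarith [ht.1, ht.2])
  have hd : ∀ᵐ x ∂Q, (P.rnDeriv Q x).toReal ∈ Set.Icc (1 - ε) (1 + ε) := by
    have := Measure.rnDeriv_withDensity Q hh.ennreal_ofReal
    rw [← hPh] at this
    filter_upwards [this] with x hx
    rw [hx, ENNReal.toReal_ofReal (by linarith [(hbound x).1])]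
    exact ⟨(hbound x).1.le, (hbound x).2.le⟩
  have hmarg : ∀ i, |fDiv f (P.map (proj (insert i (par i)))) (Q.map (proj (insert i (par i)))) -
      c * (klDiv (P.map (proj (insert i (par i)))) (Q.map (proj (insert i (par i))))).toReal| ≤
      δ * (c * (klDiv (P.map (proj (insert i (par i))))
        (Q.map (proj (insert i (par i))))).toReal) ∧
      klDiv (P.map (proj (insert i (par i)))) (Q.map (proj (insert i (par i)))) ≠ ∞ := by
    intro i
    have hm := measurable_proj (Ω := Ω) (insert i (par i))
    have : IsProbabilityMeasure (P.map (proj (insert i (par i)))) :=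
      Measure.isProbabilityMeasure_map hm.aemeasurable
    have : IsProbabilityMeasure (Q.map (proj (insert i (par i)))) :=
      Measure.isProbabilityMeasure_map hm.aemeasurable
    exact abs_fDiv_sub_klDiv_le (hPQ.map hm) hcontε hε0.le hf (rnDeriv_map_mem_Icc hPQ hm hd)
  have hjoint := (abs_fDiv_sub_klDiv_le hPQ hcontε hε0.le hf hd).1
  have hkl := ENNReal.toReal_mono (ENNReal.sum_ne_top.2 fun i _ => (hmarg i).2)
    (hP.klDiv_le_sum hpar hQ)
  rw [ENNReal.toReal_sum fun i _ => (hmarg i).2] at hkl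
  calc α * fDiv f P Q
      ≤ α * ((1 + δ) * (c * (klDiv P Q).toReal)) :=
        mul_le_mul_of_nonneg_left (by linarith [(abs_le.1 hjoint).2]) hα.1.le
    _ = α * (1 + δ) * (c * (klDiv P Q).toReal) := by ring
    _ ≤ (1 - δ) * (c * (klDiv P Q).toReal) := by
        refine mul_le_mul_of_nonneg_right ?_ (by positivity)
        nlinarith [hα.1, hα.2]
    _ ≤ (1 - δ) * (c * ∑ i, (klDiv (P.map (proj (insert i (par i))))
          (Q.map (proj (insert i (par i))))).toReal) := by
        refine mul_le_mul_of_nonneg_left (mul_le_mul_of_nonneg_left hkl hc.le) ?_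
        linarith [hα.1]
    _ ≤ ∑ i, fDiv f (P.map (proj (insert i (par i)))) (Q.map (proj (insert i (par i)))) := by
        rw [Finset.mul_sum, Finset.mul_sum]
        refine Finset.sum_le_sum fun i _ => ?_
        linarith [(abs_le.1 (hmarg i).1).1]
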